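/- Let G be a spray on a nonempty open set U ⊆ ℝ^n with n ≥ 3. Suppose W^m_{k|m} = 0 identically, and suppose there exist a volume form dV on U and a smooth function φ on U such that the S-curvature of (G,dV) satisfies S = (n+1) φ_{x^m} y^m. Then G is BWeyl-flat: there exists a volume form dV' on U such that the Berwald–Weyl curvature of (G,dV') vanishes identically. -/

import Mathlib

open scoped BigOperators
open MeasureTheory

noncomputable section BerwaldWeyl

/-- Points/vectors in local coordinates on `ℝⁿ`. -/
abbrev Vec (n : ℕ) := Fin n → ℝ

/-- Partial derivative in the base (`x`) variable along the `i`-th coordinate. -/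
def pdx {n : ℕ} (f : Vec n → Vec n → ℝ) (i : Fin n) : Vec n → Vec n → ℝ :=
  fun x y => fderiv ℝ (fun x' => f x' y) x (Pi.single i 1)

/-- Vertical derivative `f_{·i} = ∂f/∂y^i`. -/
def pdy {n : ℕ} (f : Vec n → Vec n → ℝ) (i : Fin n) : Vec n → Vec n → ℝ :=
  fun x y => fderiv ℝ (fun y' => f x y') y (Pi.single i 1)

/-- The slit fiber `ℝⁿ \ {0}`. -/
def slit (n : ℕ) : Set (Vec n) := {y | y ≠ 0}

/-- A spray on `U ⊆ ℝⁿ`: a family `G^i(x,y)`, smooth on `U × (ℝⁿ \ {0})` and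
positively 2-homogeneous in `y`. -/
def IsSpray {n : ℕ} (U : Set (Vec n)) (G : Fin n → Vec n → Vec n → ℝ) : Prop :=
  (∀ i, ContDiffOn ℝ (⊤ : ℕ∞) (fun p : Vec n × Vec n => G i p.1 p.2) (U ×ˢ slit n)) ∧
  (∀ i, ∀ x ∈ U, ∀ y ∈ slit n, ∀ c : ℝ, 0 < c → G i x (c • y) = c ^ 2 * G i x y)

/-- Nonlinear connection coefficients `N^i_j := ∂G^i/∂y^j`. -/
def Nc {n : ℕ} (G : Fin n → Vec n → Vec n → ℝ) (i j : Fin n) : Vec n → Vec n → ℝ :=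
  pdy (G i) j

/-- Berwald connection coefficients `Γ^i_{jk} := ∂²G^i/∂y^j∂y^k`. -/
def Γc {n : ℕ} (G : Fin n → Vec n → Vec n → ℝ) (i j k : Fin n) : Vec n → Vec n → ℝ :=
  pdy (pdy (G i) j) k

/-- Horizontal derivative of a scalar: `f_{|k} := δf/δx^k = ∂f/∂x^k - N^l_k ∂f/∂y^l`. -/
def hD {n : ℕ} (G : Fin n → Vec n → Vec n → ℝ) (f : Vec n → Vec n → ℝ) (k : Fin n) :
    Vec n → Vec n → ℝ :=
  fun x y => pdx f k x y - ∑ l, Nc G l k x y * pdy f l x y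

/-- Horizontal covariant derivative `A_{j|m}` of a 1-form `A_j`. -/
def covD1 {n : ℕ} (G : Fin n → Vec n → Vec n → ℝ) (A : Fin n → Vec n → Vec n → ℝ)
    (j m : Fin n) : Vec n → Vec n → ℝ :=
  fun x y => hD G (A j) m x y - ∑ l, A l x y * Γc G l j m x y

/-- Horizontal covariant derivative `A^i_{j|m}` of a (1,1)-tensor `A^i_j`. -/
def covD11 {n : ℕ} (G : Fin n → Vec n → Vec n → ℝ)
    (A : Fin n → Fin n → Vec n → Vec n → ℝ) (i j m : Fin n) : Vec n → Vec n → ℝ :=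
  fun x y => hD G (A i j) m x y + ∑ l, A l j x y * Γc G i l m x y
    - ∑ l, A i l x y * Γc G l j m x y

/-- Horizontal covariant derivative `B^i_{jk|m}` of a (1,2)-tensor `B^i_{jk}`. -/
def covD12 {n : ℕ} (G : Fin n → Vec n → Vec n → ℝ)
    (B : Fin n → Fin n → Fin n → Vec n → Vec n → ℝ) (i j k m : Fin n) : Vec n → Vec n → ℝ :=
  fun x y => hD G (B i j k) m x y + ∑ l, B l j k x y * Γc G i l m x y
    - ∑ l, B i l k x y * Γc G l j m x y - ∑ l, B i j l x y * Γc G l k m x y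

/-- Riemann curvature `R^i_k`. -/
def Riem {n : ℕ} (G : Fin n → Vec n → Vec n → ℝ) (i k : Fin n) : Vec n → Vec n → ℝ :=
  fun x y => 2 * pdx (G i) k x y - ∑ j, y j * pdy (pdx (G i) j) k x y
    + 2 * ∑ j, G j x y * Γc G i j k x y - ∑ s, Nc G i s x y * Nc G s k x y

/-- Ricci scalar `R := R^m_m/(n-1)`. -/
def Ricci {n : ℕ} (G : Fin n → Vec n → Vec n → ℝ) : Vec n → Vec n → ℝ :=
  fun x y => (∑ m, Riem G m m x y) / ((n : ℝ) - 1)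

/-- The Weyl-type curvature `T^i_k := R^i_k - (R δ^i_k - ½ R_{·k} y^i)`. -/
def Tcurv {n : ℕ} (G : Fin n → Vec n → Vec n → ℝ) (i k : Fin n) : Vec n → Vec n → ℝ :=
  fun x y => Riem G i k x y -
    (Ricci G x y * (if i = k then 1 else 0) - (1/2) * pdy (Ricci G) k x y * y i)

/-- The χ-curvature `χ_i := -(1/3) T^m_{i·m}`. -/
def chiC {n : ℕ} (G : Fin n → Vec n → Vec n → ℝ) (i : Fin n) : Vec n → Vec n → ℝ :=
  fun x y => -(1/3) * ∑ m, pdy (Tcurv G m i) m x y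

/-- The Weyl curvature `W^i_k := T^i_k + (3χ_k/(n+1)) y^i`. -/
def Weyl {n : ℕ} (G : Fin n → Vec n → Vec n → ℝ) (i k : Fin n) : Vec n → Vec n → ℝ :=
  fun x y => Tcurv G i k x y + (3 * chiC G k x y / ((n : ℝ) + 1)) * y i

/-- A volume form `dV = σ(x) dx` on `U`: `σ` smooth and positive. -/
def IsVolumeForm {n : ℕ} (U : Set (Vec n)) (σ : Vec n → ℝ) : Prop :=
  ContDiffOn ℝ (⊤ : ℕ∞) σ U ∧ ∀ x ∈ U, 0 < σ x

/-- The S-curvature of `(G, dV)`: `S := ∂G^m/∂y^m - y^m ∂(ln σ)/∂x^m`. -/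
def Scurv {n : ℕ} (G : Fin n → Vec n → Vec n → ℝ) (σ : Vec n → ℝ) : Vec n → Vec n → ℝ :=
  fun x y => ∑ m, Nc G m m x y
    - ∑ m, y m * fderiv ℝ (fun x' => Real.log (σ x')) x (Pi.single m 1)

/-- The projective spray `Ĝ^i := G^i - (S/(n+1)) y^i` of `(G, dV)`. -/
def Ghat {n : ℕ} (G : Fin n → Vec n → Vec n → ℝ) (σ : Vec n → ℝ) :
    Fin n → Vec n → Vec n → ℝ :=
  fun i x y => G i x y - (Scurv G σ x y / ((n : ℝ) + 1)) * y i

/-- The Berwald–Weyl curvature `W^o_k := R̂_{∥k} - ½ R̂_{·k∥m} y^m` of `(G, dV)`,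
where all hatted quantities and `∥` are taken with respect to the projective spray `Ĝ`. -/
def BWeyl {n : ℕ} (G : Fin n → Vec n → Vec n → ℝ) (σ : Vec n → ℝ) (k : Fin n) :
    Vec n → Vec n → ℝ :=
  fun x y => hD (Ghat G σ) (Ricci (Ghat G σ)) k x y
    - (1/2) * ∑ m, covD1 (Ghat G σ) (fun j => pdy (Ricci (Ghat G σ)) j) k m x y * y m

/-- A commutative algebra carrying commuting derivations `X i`, `Y i` that behave like the
coordinate derivatives in `x` and in `y`, the fibre coordinates `y i`, and the coefficients `g i`
of a spray. -/
structure SprayAlgebra (n : ℕ) (A : Type*) [CommRing A] [Algebra ℝ A] where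
  X : Fin n → Derivation ℝ A A
  Y : Fin n → Derivation ℝ A A
  y : Fin n → A
  g : Fin n → A
  XX : ∀ i j a, X i (X j a) = X j (X i a)
  YX : ∀ i j a, Y i (X j a) = X j (Y i a)
  YY : ∀ i j a, Y i (Y j a) = Y j (Y i a)
  Xy : ∀ i j, X i (y j) = 0
  Yy : ∀ i j, Y i (y j) = if j = i then 1 else 0
  euler : ∀ i, ∑ j, y j * Y j (g i) = 2 * g i

namespace SprayAlgebra

variable {n : ℕ} {A : Type*} [CommRing A] [Algebra ℝ A] (𝔸 : SprayAlgebra n A)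

/-- The connection coefficients `N^i_j`. -/
def N (i j : Fin n) : A := 𝔸.Y j (𝔸.g i)

/-- The Berwald connection coefficients `Γ^i_{jk}`. -/
def Γ (i j k : Fin n) : A := 𝔸.Y k (𝔸.Y j (𝔸.g i))

/-- The horizontal derivation `δ/δx^k`. -/
def δ (k : Fin n) : Derivation ℝ A A := 𝔸.X k - ∑ l, 𝔸.N l k • 𝔸.Y l

/-- The Riemann curvature `R^i_k`. -/
def riem (i k : Fin n) : A :=
  2 * 𝔸.X k (𝔸.g i) - ∑ j, 𝔸.y j * 𝔸.Y k (𝔸.X j (𝔸.g i))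
    + 2 * ∑ j, 𝔸.g j * 𝔸.Γ i j k - ∑ s, 𝔸.N i s * 𝔸.N s k

/-- The Ricci scalar. -/
def ricci : A := (∑ m, 𝔸.riem m m) * algebraMap ℝ A ((n : ℝ) - 1)⁻¹

/-- The trace-adjusted curvature `T^i_k`. -/
def T (i k : Fin n) : A :=
  𝔸.riem i k - (𝔸.ricci * (if i = k then 1 else 0)
    - algebraMap ℝ A (1 / 2) * 𝔸.Y k 𝔸.ricci * 𝔸.y i)

/-- The `χ`-curvature. -/
def χ (i : Fin n) : A := algebraMap ℝ A (-(1 / 3)) * ∑ m, 𝔸.Y m (𝔸.T m i)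

/-- The Weyl curvature. -/
def weyl (i k : Fin n) : A :=
  𝔸.T i k + (3 * 𝔸.χ k * algebraMap ℝ A ((n : ℝ) + 1)⁻¹) * 𝔸.y i

/-- The horizontal divergence `B^m_{k|m}` of a `(1,1)`-tensor. -/
def div (B : Fin n → Fin n → A) (k : Fin n) : A :=
  ∑ m, (𝔸.δ m (B m k) + ∑ l, B l k * 𝔸.Γ m l m - ∑ l, B m l * 𝔸.Γ l k m)

/-- The form `R_{|k} - ½ R_{·k|m} y^m`. -/
def bweyl (k : Fin n) : A :=
  𝔸.δ k 𝔸.ricci - algebraMap ℝ A (1 / 2) *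
    ∑ m, (𝔸.δ m (𝔸.Y k 𝔸.ricci) - ∑ l, 𝔸.Y l 𝔸.ricci * 𝔸.Γ l k m) * 𝔸.y m

/-- The curvature `R^i_{jk}` of the nonlinear connection. -/
def curv (i j k : Fin n) : A := 𝔸.δ j (𝔸.N i k) - 𝔸.δ k (𝔸.N i j)

/-- The trace `R^m_{mk}` of the curvature of the nonlinear connection. -/
def P (k : Fin n) : A := ∑ m, 𝔸.curv m m k

lemma δ_apply (k : Fin n) (a : A) : 𝔸.δ k a = 𝔸.X k a - ∑ l, 𝔸.N l k * 𝔸.Y l a := by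
  simp only [δ, Derivation.sub_apply, ← Derivation.coeFnAddMonoidHom_apply, map_sum]
  simp [Finset.sum_apply]

lemma δ_y (k j : Fin n) : 𝔸.δ k (𝔸.y j) = -𝔸.N j k := by
  simp [δ_apply, 𝔸.Xy, 𝔸.Yy]

lemma Γ_symm (i j k : Fin n) : 𝔸.Γ i j k = 𝔸.Γ i k j := 𝔸.YY _ _ _

lemma curv_antisymm (i j k : Fin n) : 𝔸.curv i j k = -𝔸.curv i k j := by
  simp [curv]

lemma sum_N_y (i : Fin n) : ∑ j, 𝔸.N i j * 𝔸.y j = 2 * 𝔸.g i := by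
  rw [← 𝔸.euler]; simp [N, mul_comm]

lemma sum_y_Γ (i j : Fin n) : ∑ k, 𝔸.y k * 𝔸.Γ i j k = 𝔸.N i j := by
  have h := congrArg (𝔸.Y j) (𝔸.euler i)
  simp only [map_sum, Derivation.leibniz, smul_eq_mul, 𝔸.Yy, Finset.sum_add_distrib, mul_ite,
    mul_one, mul_zero, Finset.sum_ite_eq', Finset.mem_univ, if_true] at h
  have h2 : 𝔸.Y j (2 : A) = 0 := by simpa using (𝔸.Y j).map_natCast 2
  rw [h2] at h
  simp only [Γ, N, 𝔸.YY _ j]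
  linear_combination h

lemma sum_Γ_y (i j : Fin n) : ∑ k, 𝔸.Γ i j k * 𝔸.y k = 𝔸.N i j := by
  simpa [mul_comm] using 𝔸.sum_y_Γ i j

lemma Y_δ (j k : Fin n) (a : A) :
    𝔸.Y j (𝔸.δ k a) = 𝔸.δ k (𝔸.Y j a) - ∑ l, 𝔸.Γ l k j * 𝔸.Y l a := by
  simp only [δ_apply, map_sub, map_sum, Derivation.leibniz, smul_eq_mul, 𝔸.YX,
    Finset.sum_add_distrib, N, Γ, 𝔸.YY j _ a]
  simp only [mul_comm (𝔸.Y _ a)]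
  ring

lemma δ_δ (j k : Fin n) (a : A) :
    𝔸.δ j (𝔸.δ k a) - 𝔸.δ k (𝔸.δ j a) = -∑ l, 𝔸.curv l j k * 𝔸.Y l a := by
  have key (j k : Fin n) : 𝔸.δ j (𝔸.δ k a) = 𝔸.X j (𝔸.X k a) - ∑ l, 𝔸.N l j * 𝔸.X k (𝔸.Y l a)
      - ∑ l, 𝔸.N l k * 𝔸.X j (𝔸.Y l a) + ∑ l, ∑ m, 𝔸.N l k * 𝔸.N m j * 𝔸.Y m (𝔸.Y l a)
      - ∑ l, 𝔸.δ j (𝔸.N l k) * 𝔸.Y l a := by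
    rw [𝔸.δ_apply k a]
    simp only [map_sub, map_sum, Derivation.leibniz, smul_eq_mul, Finset.sum_add_distrib]
    simp only [𝔸.δ_apply j (𝔸.X k a), 𝔸.δ_apply j (𝔸.Y _ a), mul_sub, Finset.sum_sub_distrib,
      𝔸.YX, Finset.mul_sum, mul_assoc, mul_comm (𝔸.Y _ a)]
    ring
  have hs : ∑ l, ∑ m, 𝔸.N l k * 𝔸.N m j * 𝔸.Y m (𝔸.Y l a)
      = ∑ l, ∑ m, 𝔸.N l j * 𝔸.N m k * 𝔸.Y m (𝔸.Y l a) := by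
    rw [Finset.sum_comm]
    refine Finset.sum_congr rfl fun l _ => Finset.sum_congr rfl fun m _ => ?_
    rw [𝔸.YY]; ring
  rw [key j k, key k j, hs, 𝔸.XX j k]
  simp only [curv, sub_mul, Finset.sum_sub_distrib]
  ring

/-- The Bianchi identity for the curvature of the nonlinear connection. -/
lemma bianchi (l i j k : Fin n) :
    𝔸.δ i (𝔸.curv l j k) + 𝔸.δ j (𝔸.curv l k i) + 𝔸.δ k (𝔸.curv l i j)
      + ∑ m, 𝔸.curv m j k * 𝔸.Γ l i m + ∑ m, 𝔸.curv m k i * 𝔸.Γ l j m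
      + ∑ m, 𝔸.curv m i j * 𝔸.Γ l k m = 0 := by
  have h1 := 𝔸.δ_δ i j (𝔸.N l k)
  have h2 := 𝔸.δ_δ j k (𝔸.N l i)
  have h3 := 𝔸.δ_δ k i (𝔸.N l j)
  change _ = -∑ m, 𝔸.curv m i j * 𝔸.Γ l k m at h1
  change _ = -∑ m, 𝔸.curv m j k * 𝔸.Γ l i m at h2
  change _ = -∑ m, 𝔸.curv m k i * 𝔸.Γ l j m at h3
  have e (i j k : Fin n) : 𝔸.δ i (𝔸.curv l j k)
      = 𝔸.δ i (𝔸.δ j (𝔸.N l k)) - 𝔸.δ i (𝔸.δ k (𝔸.N l j)) := by simp [curv]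
  rw [e, e, e]
  linear_combination h1 + h2 + h3

lemma sum_curv_y (i j : Fin n) : ∑ k, 𝔸.curv i j k * 𝔸.y k = 𝔸.riem i j := by
  have h := congrArg (𝔸.δ j) (𝔸.sum_N_y i)
  have h2 : 𝔸.δ j (2 : A) = 0 := by simpa using (𝔸.δ j).map_natCast 2
  simp only [map_sum, Derivation.leibniz, smul_eq_mul, δ_y, h2, Finset.sum_add_distrib] at h
  have h3 : ∑ k, 𝔸.y k * 𝔸.δ k (𝔸.N i j) =
      ∑ k, 𝔸.y k * 𝔸.Y j (𝔸.X k (𝔸.g i)) - 2 * ∑ l, 𝔸.g l * 𝔸.Γ i l j := by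
    simp only [δ_apply, mul_sub, Finset.sum_sub_distrib, Finset.mul_sum, 𝔸.YX]
    congr 1
    rw [Finset.sum_comm]
    refine Finset.sum_congr rfl fun l _ => ?_
    rw [← mul_assoc, ← 𝔸.sum_N_y, Finset.sum_mul, 𝔸.Γ_symm]
    refine Finset.sum_congr rfl fun k _ => ?_
    simp only [N, Γ]; ring
  simp only [curv, sub_mul, Finset.sum_sub_distrib, riem]
  simp only [mul_comm _ (𝔸.y _), h3]
  rw [𝔸.δ_apply j (𝔸.g i)] at h
  simp only [mul_neg, Finset.sum_neg_distrib] at h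
  have h4 : ∑ l, 𝔸.N l j * 𝔸.Y l (𝔸.g i) = ∑ s, 𝔸.N i s * 𝔸.N s j :=
    Finset.sum_congr rfl fun s _ => mul_comm _ _
  rw [h4] at h
  linear_combination h

lemma sum_y_P : ∑ k, 𝔸.P k * 𝔸.y k = ∑ m, 𝔸.riem m m := by
  simp only [P, Finset.sum_mul]
  rw [Finset.sum_comm]
  simp only [sum_curv_y]

lemma euler_δ (k : Fin n) (a : A) :
    ∑ j, 𝔸.y j * 𝔸.Y j (𝔸.δ k a) = 𝔸.δ k (∑ j, 𝔸.y j * 𝔸.Y j a) := by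
  simp only [Y_δ, mul_sub, Finset.sum_sub_distrib, map_sum, Derivation.leibniz, smul_eq_mul, δ_y,
    Finset.sum_add_distrib, Finset.mul_sum]
  rw [Finset.sum_comm (f := fun j l => 𝔸.y j * (𝔸.Γ l k j * 𝔸.Y l a)), sub_eq_add_neg,
    ← Finset.sum_neg_distrib]
  congr 1
  refine Finset.sum_congr rfl fun l _ => ?_
  rw [← 𝔸.sum_y_Γ l k, mul_neg, Finset.mul_sum]
  congr 1
  exact Finset.sum_congr rfl fun j _ => by ring

lemma euler_P (k : Fin n) : ∑ j, 𝔸.y j * 𝔸.Y j (𝔸.P k) = 𝔸.P k := by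
  have h (i j k : Fin n) : ∑ l, 𝔸.y l * 𝔸.Y l (𝔸.curv i j k) = 𝔸.curv i j k := by
    simp only [curv, map_sub, mul_sub, Finset.sum_sub_distrib, euler_δ]
    congr 2 <;> exact 𝔸.sum_y_Γ _ _
  simp only [P, map_sum, Finset.mul_sum]
  rw [Finset.sum_comm]
  simp only [h]

/-- The contracted Bianchi identity. -/
lemma div_riem (k : Fin n) :
    𝔸.div 𝔸.riem k = 𝔸.δ k (∑ m, 𝔸.riem m m) + ∑ j, 𝔸.P j * 𝔸.N j k
      - ∑ j, 𝔸.δ j (𝔸.P k) * 𝔸.y j := by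
  have hb : ∑ j, ∑ m, (𝔸.δ m (𝔸.curv m k j) + 𝔸.δ k (𝔸.curv m j m) + 𝔸.δ j (𝔸.curv m m k)
      + ∑ l, 𝔸.curv l k j * 𝔸.Γ m m l + ∑ l, 𝔸.curv l j m * 𝔸.Γ m k l
      + ∑ l, 𝔸.curv l m k * 𝔸.Γ m j l) * 𝔸.y j = 0 := by
    simp [bianchi]
  simp only [add_mul, Finset.sum_add_distrib] at hb
  have t1 : ∑ j, ∑ m, 𝔸.δ m (𝔸.curv m k j) * 𝔸.y j
      = ∑ m, 𝔸.δ m (𝔸.riem m k) + ∑ m, ∑ j, 𝔸.curv m k j * 𝔸.N j m := by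
    rw [Finset.sum_comm, ← Finset.sum_add_distrib]
    refine Finset.sum_congr rfl fun m _ => ?_
    rw [← sum_curv_y, map_sum, ← Finset.sum_add_distrib]
    refine Finset.sum_congr rfl fun j _ => ?_
    rw [Derivation.leibniz, δ_y, smul_eq_mul, smul_eq_mul]; ring
  have t2 : ∑ j, ∑ m, 𝔸.δ k (𝔸.curv m j m) * 𝔸.y j
      = -𝔸.δ k (∑ m, 𝔸.riem m m) - ∑ j, 𝔸.P j * 𝔸.N j k := by
    rw [← sum_y_P, map_sum, ← Finset.sum_neg_distrib, ← Finset.sum_sub_distrib]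
    refine Finset.sum_congr rfl fun j _ => ?_
    rw [Derivation.leibniz, δ_y, smul_eq_mul, smul_eq_mul, ← Finset.sum_mul, ← map_sum,
      show ∑ m, 𝔸.curv m j m = -𝔸.P j by
        rw [P, ← Finset.sum_neg_distrib]
        exact Finset.sum_congr rfl fun m _ => 𝔸.curv_antisymm _ _ _, map_neg]
    ring
  have t3 : ∑ j, ∑ m, 𝔸.δ j (𝔸.curv m m k) * 𝔸.y j = ∑ j, 𝔸.δ j (𝔸.P k) * 𝔸.y j := by
    simp [P, Finset.sum_mul]
  have t4 : ∑ j, ∑ m, (∑ l, 𝔸.curv l k j * 𝔸.Γ m m l) * 𝔸.y j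
      = ∑ m, ∑ l, 𝔸.riem l k * 𝔸.Γ m l m := by
    rw [Finset.sum_comm]
    refine Finset.sum_congr rfl fun m _ => ?_
    simp only [Finset.sum_mul, ← sum_curv_y]
    rw [Finset.sum_comm]
    refine Finset.sum_congr rfl fun l _ => Finset.sum_congr rfl fun j _ => ?_
    rw [𝔸.Γ_symm m m l]; ring
  have t5 : ∑ j, ∑ m, (∑ l, 𝔸.curv l j m * 𝔸.Γ m k l) * 𝔸.y j
      = -∑ m, ∑ l, 𝔸.riem m l * 𝔸.Γ l k m := by
    rw [Finset.sum_comm, Finset.sum_comm (f := fun m l => 𝔸.riem m l * 𝔸.Γ l k m),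
      ← Finset.sum_neg_distrib]
    refine Finset.sum_congr rfl fun m _ => ?_
    simp only [Finset.sum_mul, ← sum_curv_y]
    rw [Finset.sum_comm, ← Finset.sum_neg_distrib]
    refine Finset.sum_congr rfl fun l _ => ?_
    rw [← Finset.sum_neg_distrib]
    refine Finset.sum_congr rfl fun j _ => ?_
    rw [𝔸.curv_antisymm l m j]; ring
  have t6 : ∑ j, ∑ m, (∑ l, 𝔸.curv l m k * 𝔸.Γ m j l) * 𝔸.y j
      = -∑ m, ∑ j, 𝔸.curv m k j * 𝔸.N j m := by
    rw [Finset.sum_comm, Finset.sum_comm (f := fun m j => 𝔸.curv m k j * 𝔸.N j m),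
      ← Finset.sum_neg_distrib]
    refine Finset.sum_congr rfl fun m _ => ?_
    simp only [Finset.sum_mul]
    rw [Finset.sum_comm, ← Finset.sum_neg_distrib]
    refine Finset.sum_congr rfl fun l _ => ?_
    rw [← sum_y_Γ, 𝔸.curv_antisymm l m k, ← mul_neg, ← Finset.sum_neg_distrib, Finset.mul_sum]
    refine Finset.sum_congr rfl fun j _ => ?_
    rw [𝔸.Γ_symm m j l]; ring
  simp only [div, Finset.sum_add_distrib, Finset.sum_sub_distrib]
  rw [t1, t2, t3, t4, t5, t6] at hb
  linear_combination hb

/-- The divergence of `T` in terms of that of the Riemann curvature. -/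
lemma div_T (k : Fin n) : 𝔸.div 𝔸.T k = 𝔸.div 𝔸.riem k - 𝔸.bweyl k := by
  set c := algebraMap ℝ A (1 / 2) with hc
  have hδc (m : Fin n) : 𝔸.δ m c = 0 := (𝔸.δ m).map_algebraMap _
  have hδi (m : Fin n) (p : Prop) [Decidable p] : 𝔸.δ m (if p then 1 else 0 : A) = 0 := by
    split_ifs <;> simp
  set r := 𝔸.ricci with hr
  have e1 : ∑ m, 𝔸.δ m (𝔸.T m k) = ∑ m, 𝔸.δ m (𝔸.riem m k) - 𝔸.δ k r
      + c * (∑ m, 𝔸.δ m (𝔸.Y k r) * 𝔸.y m - ∑ m, 𝔸.Y k r * 𝔸.N m m) := by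
    simp only [T, map_sub, Derivation.leibniz, smul_eq_mul, δ_y, hδc, hδi, ← hc, ← hr,
      Finset.sum_sub_distrib, Finset.sum_add_distrib, Finset.mul_sum, mul_sub]
    simp only [mul_zero, ite_mul, one_mul, zero_mul, Finset.sum_ite_eq', Finset.mem_univ, if_true,
      Finset.sum_const_zero, mul_neg, Finset.sum_neg_distrib, zero_add, add_zero]
    simp only [mul_assoc, mul_comm (𝔸.y _)]
    ring
  have e2 : ∑ m, ∑ l, 𝔸.T l k * 𝔸.Γ m l m = ∑ m, ∑ l, 𝔸.riem l k * 𝔸.Γ m l m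
      - ∑ m, r * 𝔸.Γ m k m + c * ∑ m, 𝔸.Y k r * 𝔸.N m m := by
    rw [Finset.mul_sum, ← Finset.sum_sub_distrib, ← Finset.sum_add_distrib]
    refine Finset.sum_congr rfl fun m _ => ?_
    simp only [T, sub_mul, ← hc, ← hr, Finset.sum_sub_distrib]
    simp only [mul_ite, mul_one, mul_zero, ite_mul, zero_mul, Finset.sum_ite_eq', Finset.mem_univ,
      if_true, mul_assoc, ← Finset.mul_sum, 𝔸.Γ_symm m _ m, sum_y_Γ]
    ring
  have e3 : ∑ m, ∑ l, 𝔸.T m l * 𝔸.Γ l k m = ∑ m, ∑ l, 𝔸.riem m l * 𝔸.Γ l k m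
      - ∑ m, r * 𝔸.Γ m k m + c * ∑ m, (∑ l, 𝔸.Y l r * 𝔸.Γ l k m) * 𝔸.y m := by
    rw [Finset.mul_sum, ← Finset.sum_sub_distrib, ← Finset.sum_add_distrib]
    refine Finset.sum_congr rfl fun m _ => ?_
    simp only [T, sub_mul, ← hc, ← hr, Finset.sum_sub_distrib]
    simp only [mul_ite, mul_one, mul_zero, ite_mul, zero_mul, Finset.sum_ite_eq, Finset.mem_univ,
      if_true, Finset.mul_sum, Finset.sum_mul]
    rw [Finset.sum_congr rfl fun l _ => show c * 𝔸.Y l r * 𝔸.y m * 𝔸.Γ l k m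
      = c * (𝔸.Y l r * 𝔸.Γ l k m * 𝔸.y m) by ring]
    ring
  simp only [div, bweyl, Finset.sum_add_distrib, Finset.sum_sub_distrib, sub_mul, ← hc, ← hr]
  rw [e1, e2, e3]
  ring

section VanishingS

variable {𝔸} {L : A} (hYL : ∀ i, 𝔸.Y i L = 0)
  (hL : ∑ m, 𝔸.N m m = ∑ m, 𝔸.y m * 𝔸.X m L)

include hYL

lemma Y_X_eq_zero (i j : Fin n) : 𝔸.Y i (𝔸.X j L) = 0 := by
  rw [𝔸.YX, hYL, map_zero]

lemma δ_X (i j : Fin n) : 𝔸.δ i (𝔸.X j L) = 𝔸.X i (𝔸.X j L) := by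
  simp [δ_apply, Y_X_eq_zero hYL]

include hL

lemma sum_Γ_trace (k : Fin n) : ∑ m, 𝔸.Γ m k m = 𝔸.X k L := by
  have h := congrArg (𝔸.Y k) hL
  simp only [map_sum, Derivation.leibniz, smul_eq_mul, Y_X_eq_zero hYL, 𝔸.Yy, mul_zero, mul_ite,
    mul_one, zero_add, Finset.sum_ite_eq', Finset.mem_univ, if_true] at h
  rw [← h]
  exact Finset.sum_congr rfl fun m _ => 𝔸.Γ_symm m k m

lemma Y_P_symm (j k : Fin n) : 𝔸.Y j (𝔸.P k) = 𝔸.Y k (𝔸.P j) := by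
  have hP (k : Fin n) : 𝔸.P k = ∑ m, 𝔸.δ m (𝔸.N m k)
      - (∑ m, 𝔸.y m * 𝔸.X k (𝔸.X m L) - ∑ l, 𝔸.N l k * 𝔸.X l L) := by
    simp only [P, curv, Finset.sum_sub_distrib]
    rw [← map_sum, hL, map_sum]
    simp only [Derivation.leibniz, δ_X hYL, δ_y, smul_eq_mul, Finset.sum_add_distrib,
      mul_comm (𝔸.X _ L)]
    simp only [neg_mul, Finset.sum_neg_distrib]
    ring
  have hYXX (i j k : Fin n) : 𝔸.Y i (𝔸.X j (𝔸.X k L)) = 0 := by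
    rw [𝔸.YX, Y_X_eq_zero hYL, map_zero]
  have hY (j k : Fin n) : 𝔸.Y j (𝔸.P k) = ∑ m, 𝔸.δ m (𝔸.Γ m k j)
      - ∑ m, ∑ l, 𝔸.Γ l m j * 𝔸.Γ m k l - 𝔸.X k (𝔸.X j L) + ∑ l, 𝔸.X l L * 𝔸.Γ l k j := by
    rw [hP]
    simp only [map_sub, map_sum, Y_δ, Derivation.leibniz, smul_eq_mul, Y_X_eq_zero hYL, hYXX, 𝔸.Yy,
      mul_zero, zero_add, mul_ite, mul_one, Finset.sum_ite_eq', Finset.mem_univ, if_true,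
      Finset.sum_sub_distrib, N, Γ]
    ring
  rw [hY, hY, 𝔸.XX k j, Finset.sum_comm (f := fun m l => 𝔸.Γ l m j * 𝔸.Γ m k l)]
  simp only [𝔸.Γ_symm _ k j]
  congr 3
  refine Finset.sum_congr rfl fun l _ => Finset.sum_congr rfl fun m _ => ?_
  rw [𝔸.Γ_symm l m j, 𝔸.Γ_symm m k l]; ring

lemma Y_sum_riem (j : Fin n) : 𝔸.Y j (∑ m, 𝔸.riem m m) = 2 * 𝔸.P j := by
  rw [← sum_y_P]
  simp only [map_sum, Derivation.leibniz, smul_eq_mul, 𝔸.Yy, mul_ite, mul_one, mul_zero,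
    Finset.sum_add_distrib, Finset.sum_ite_eq', Finset.mem_univ, if_true, Y_P_symm hYL hL j,
    euler_P]
  ring

lemma sum_Y_riem (j : Fin n) : ∑ m, 𝔸.Y m (𝔸.riem m j) = -𝔸.P j := by
  have h (k : Fin n) : ∑ m, 𝔸.Y m (𝔸.curv m j k) = 0 := by
    have h1 (j k : Fin n) : ∑ m, 𝔸.Y m (𝔸.δ j (𝔸.N m k))
        = 𝔸.X j (𝔸.X k L) - ∑ m, ∑ l, 𝔸.Γ l j m * 𝔸.Γ m k l := by
      simp only [Y_δ, Finset.sum_sub_distrib]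
      rw [← map_sum, ← δ_X hYL, ← sum_Γ_trace hYL hL k]
      rfl
    simp only [curv, map_sub, Finset.sum_sub_distrib, h1]
    rw [Finset.sum_comm (f := fun m l => 𝔸.Γ l j m * 𝔸.Γ m k l), 𝔸.XX j k]
    simp only [mul_comm]
    ring
  have h2 : ∑ m, 𝔸.curv m j m = -𝔸.P j := by
    rw [P, ← Finset.sum_neg_distrib]
    exact Finset.sum_congr rfl fun m _ => 𝔸.curv_antisymm _ _ _
  simp only [← sum_curv_y, map_sum, Derivation.leibniz, smul_eq_mul, 𝔸.Yy, mul_ite, mul_one,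
    mul_zero, Finset.sum_add_distrib, Finset.sum_ite_eq', Finset.mem_univ, if_true]
  rw [h2, Finset.sum_comm]
  simp only [← Finset.mul_sum, h, mul_zero, Finset.sum_const_zero, add_zero]

lemma Y_ricci (j : Fin n) :
    𝔸.Y j 𝔸.ricci = 2 * 𝔸.P j * algebraMap ℝ A ((n : ℝ) - 1)⁻¹ := by
  rw [ricci, Derivation.leibniz, Y_sum_riem hYL hL, Derivation.map_algebraMap, smul_eq_mul,
    smul_eq_mul]
  ring

omit hYL hL in
lemma natCast_sub_one_mul_inv (A : Type*) [CommRing A] [Algebra ℝ A] (hn : 3 ≤ n) :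
    ((n : A) - 1) * algebraMap ℝ A ((n : ℝ) - 1)⁻¹ = 1 := by
  have : (3 : ℝ) ≤ n := by exact_mod_cast hn
  rw [← map_natCast (algebraMap ℝ A) n, ← map_one (algebraMap ℝ A), ← map_sub, ← map_mul,
    mul_inv_cancel₀ (by linarith)]

omit hYL hL in
lemma two_mul_half (A : Type*) [CommRing A] [Algebra ℝ A] :
    2 * algebraMap ℝ A (1 / 2) = 1 := by
  rw [← map_ofNat (algebraMap ℝ A) 2, ← map_mul]; norm_num

lemma χ_eq_zero (hn : 3 ≤ n) (k : Fin n) : 𝔸.χ k = 0 := by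
  set c := algebraMap ℝ A (1 / 2) with hc
  set d := algebraMap ℝ A ((n : ℝ) - 1)⁻¹ with hd
  have hcc : 2 * c = 1 := two_mul_half A
  have hdd : ((n : A) - 1) * d = 1 := natCast_sub_one_mul_inv A hn
  have hYc (m : Fin n) : 𝔸.Y m c = 0 := (𝔸.Y m).map_algebraMap _
  have hYd (m : Fin n) : 𝔸.Y m d = 0 := (𝔸.Y m).map_algebraMap _
  have hYr (j : Fin n) : 𝔸.Y j 𝔸.ricci = 2 * 𝔸.P j * d := Y_ricci hYL hL j
  have hYi (m : Fin n) (p : Prop) [Decidable p] : 𝔸.Y m (if p then 1 else 0 : A) = 0 := by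
    split_ifs <;> simp
  have hYY : ∑ m, 𝔸.y m * 𝔸.Y m (𝔸.Y k 𝔸.ricci) = 2 * 𝔸.P k * d := by
    have h2 (m : Fin n) : 𝔸.Y m (2 : A) = 0 := by simpa using (𝔸.Y m).map_natCast 2
    simp only [hYr, Derivation.leibniz, smul_eq_mul, hYd, h2, mul_zero, add_zero, zero_add]
    rw [← 𝔸.euler_P k, Finset.mul_sum, Finset.sum_mul]
    simp only [euler_P]
    exact Finset.sum_congr rfl fun m _ => by ring
  have hT : ∑ m, 𝔸.Y m (𝔸.T m k) = 0 := by
    simp only [T, map_sub, Derivation.leibniz, smul_eq_mul, hYc, hYi, 𝔸.Yy, ← hc,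
      Finset.sum_sub_distrib, Finset.sum_add_distrib, sum_Y_riem hYL hL]
    simp only [mul_zero, ite_mul, one_mul, zero_mul, Finset.sum_ite_eq', Finset.mem_univ, if_true,
      Finset.sum_const_zero, zero_add, add_zero, mul_one, Finset.sum_const, Finset.card_univ,
      Fintype.card_fin, nsmul_eq_mul]
    rw [Finset.sum_congr rfl fun m _ => show 𝔸.y m * (c * 𝔸.Y m (𝔸.Y k 𝔸.ricci))
      = c * (𝔸.y m * 𝔸.Y m (𝔸.Y k 𝔸.ricci)) by ring, ← Finset.mul_sum, hYY, hYr]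
    linear_combination (𝔸.P k) * hdd + (𝔸.P k * d * (n + 1)) * hcc
  rw [χ, hT, mul_zero]

lemma div_riem_eq_bweyl (hn : 3 ≤ n) (k : Fin n) :
    𝔸.div 𝔸.riem k = ((n : A) - 1) * 𝔸.bweyl k := by
  have hdd := natCast_sub_one_mul_inv A hn
  have hcc := two_mul_half A
  have hR : ∑ m, 𝔸.riem m m = ((n : A) - 1) * 𝔸.ricci := by
    rw [ricci]; linear_combination (-∑ m, 𝔸.riem m m) * hdd
  have hP (j : Fin n) : 𝔸.P j = ((n : A) - 1) * algebraMap ℝ A (1 / 2) * 𝔸.Y j 𝔸.ricci := by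
    rw [Y_ricci hYL hL]
    linear_combination (-𝔸.P j) * hdd - (𝔸.P j * ((n : A) - 1)
      * algebraMap ℝ A ((n : ℝ) - 1)⁻¹) * hcc
  have hδ (m : Fin n) (b : A) : 𝔸.δ m (((n : A) - 1) * b) = ((n : A) - 1) * 𝔸.δ m b := by
    simp [Derivation.leibniz]
  have hδ' (m : Fin n) (b : A) : 𝔸.δ m (((n : A) - 1) * algebraMap ℝ A (1 / 2) * b)
      = ((n : A) - 1) * algebraMap ℝ A (1 / 2) * 𝔸.δ m b := by
    rw [mul_assoc, hδ, Derivation.leibniz, Derivation.map_algebraMap, smul_eq_mul, smul_zero,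
      add_zero, mul_assoc]
  have hN : ∑ j, 𝔸.Y j 𝔸.ricci * 𝔸.N j k
      = ∑ m, (∑ l, 𝔸.Y l 𝔸.ricci * 𝔸.Γ l k m) * 𝔸.y m := by
    simp only [Finset.sum_mul]
    rw [Finset.sum_comm]
    refine Finset.sum_congr rfl fun j _ => ?_
    rw [← sum_Γ_y, Finset.mul_sum]
    exact Finset.sum_congr rfl fun m _ => by ring
  rw [div_riem, hR, bweyl]
  simp only [hP, hδ, hδ']
  simp only [mul_assoc, ← Finset.mul_sum, hN, sub_mul, Finset.sum_sub_distrib]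
  ring

/-- If the S-curvature vanishes, the Weyl curvature has divergence `(n - 2) W^o`. -/
theorem bweyl_eq_zero (hn : 3 ≤ n) (h : ∀ k, 𝔸.div 𝔸.weyl k = 0) (k : Fin n) : 𝔸.bweyl k = 0 := by
  have hw : 𝔸.weyl = 𝔸.T := by
    funext i k; simp [weyl, χ_eq_zero hYL hL hn]
  have h1 := h k
  rw [hw, div_T, div_riem_eq_bweyl hYL hL hn] at h1
  have h2 : ((n : ℝ) - 2) • 𝔸.bweyl k = 0 := by
    rw [← h1, Algebra.smul_def, map_sub, map_natCast, map_ofNat]; ring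
  have : (3 : ℝ) ≤ n := by exact_mod_cast hn
  exact (smul_eq_zero_iff_right (by linarith)).1 h2

end VanishingS

end SprayAlgebra

section SmoothFunctions

variable {E : Type*} [NormedAddCommGroup E] [NormedSpace ℝ E]

/-- The algebra of smooth real functions on an open set `O`. -/
def smoothAlgebra (O : Set E) : Subalgebra ℝ (O → ℝ) where
  carrier := {f | ∃ g : E → ℝ, ContDiffOn ℝ (⊤ : ℕ∞) g O ∧ ∀ p : O, f p = g p}
  mul_mem' := by
    rintro _ _ ⟨g, hg, h⟩ ⟨g', hg', h'⟩
    exact ⟨fun p => g p * g' p, hg.mul hg', fun p => by simp [h, h']⟩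
  add_mem' := by
    rintro _ _ ⟨g, hg, h⟩ ⟨g', hg', h'⟩
    exact ⟨fun p => g p + g' p, hg.add hg', fun p => by simp [h, h']⟩
  algebraMap_mem' r := ⟨fun _ => r, contDiffOn_const, fun _ => rfl⟩

namespace smoothAlgebra

variable {O : Set E}

/-- The element of `smoothAlgebra O` given by a function that is smooth on `O`. -/
def mk (g : E → ℝ) (hg : ContDiffOn ℝ (⊤ : ℕ∞) g O) : smoothAlgebra O :=
  ⟨fun p => g p, g, hg, fun _ => rfl⟩

/-- An arbitrary extension of a smooth function on `O` to the whole space. -/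
def extension (f : smoothAlgebra O) : E → ℝ := Classical.choose f.2

lemma contDiffOn_extension (f : smoothAlgebra O) : ContDiffOn ℝ (⊤ : ℕ∞) (extension f) O :=
  (Classical.choose_spec f.2).1

lemma extension_apply (f : smoothAlgebra O) (p : O) : (extension f) p = f.1 p :=
  ((Classical.choose_spec f.2).2 p).symm

lemma eventuallyEq_extension (hO : IsOpen O) (f : smoothAlgebra O) {g : E → ℝ}
    (h : ∀ p : O, f.1 p = g p) (p : O) : g =ᶠ[nhds (p : E)] (extension f) := by
  filter_upwards [hO.mem_nhds p.2] with q hq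
  rw [extension_apply f ⟨q, hq⟩, h]

lemma differentiableAt_of_eq (hO : IsOpen O) (f : smoothAlgebra O) {g : E → ℝ}
    (h : ∀ p : O, f.1 p = g p) (p : O) : DifferentiableAt ℝ g p :=
  (((contDiffOn_extension f).differentiableOn (by simp)).differentiableAt
    (hO.mem_nhds p.2)).congr_of_eventuallyEq (eventuallyEq_extension hO f h p)

/-- The directional derivative as a linear map. -/
def derivLinear (hO : IsOpen O) (v : E) : smoothAlgebra O →ₗ[ℝ] smoothAlgebra O where
  toFun f := mk (fun p => fderiv ℝ (extension f) p v)
    (((contDiffOn_extension f).fderiv_of_isOpen hO (by simp)).clm_apply contDiffOn_const)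
  map_add' f g := by
    ext p
    change fderiv ℝ (extension (f + g)) p v
      = fderiv ℝ (extension f) p v + fderiv ℝ (extension g) p v
    rw [← (eventuallyEq_extension hO (f + g) (g := fun q => (extension f) q + (extension g) q)
      (fun q => by simp [extension_apply]) p).fderiv_eq, fderiv_fun_add
      (differentiableAt_of_eq hO f (fun q => (extension_apply f q).symm) p)
      (differentiableAt_of_eq hO g (fun q => (extension_apply g q).symm) p)]
    rfl
  map_smul' r f := by
    ext p
    change fderiv ℝ (extension (r • f)) p v = r * fderiv ℝ (extension f) p v
    rw [← (eventuallyEq_extension hO (r • f) (g := fun q => r * (extension f) q)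
      (fun q => by simp [extension_apply]) p).fderiv_eq, fderiv_const_mul
      (differentiableAt_of_eq hO f (fun q => (extension_apply f q).symm) p)]
    rfl

/-- The directional derivative along `v`, as a derivation of the algebra of smooth functions. -/
def deriv (hO : IsOpen O) (v : E) : Derivation ℝ (smoothAlgebra O) (smoothAlgebra O) :=
  Derivation.mk' (derivLinear hO v) fun f g => by
    ext p
    change fderiv ℝ (extension (f * g)) p v
      = f.1 p * fderiv ℝ (extension g) p v + g.1 p * fderiv ℝ (extension f) p v
    rw [← (eventuallyEq_extension hO (f * g) (g := fun q => (extension f) q * (extension g) q)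
      (fun q => by simp [extension_apply]) p).fderiv_eq, fderiv_fun_mul
      (differentiableAt_of_eq hO f (fun q => (extension_apply f q).symm) p)
      (differentiableAt_of_eq hO g (fun q => (extension_apply g q).symm) p)]
    simp [extension_apply]

lemma deriv_apply (hO : IsOpen O) (v : E) (f : smoothAlgebra O) {g : E → ℝ}
    (h : ∀ p : O, f.1 p = g p) (p : O) : (deriv hO v f).1 p = fderiv ℝ g p v := by
  rw [(eventuallyEq_extension hO f h p).fderiv_eq]; rfl

lemma deriv_comm (hO : IsOpen O) (v w : E) (f : smoothAlgebra O) :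
    deriv hO v (deriv hO w f) = deriv hO w (deriv hO v f) := by
  ext p
  have h2 : (2 : WithTop ℕ∞) ≤ ((⊤ : ℕ∞) : WithTop ℕ∞) := WithTop.coe_le_coe.2 le_top
  have hf : ContDiffAt ℝ (⊤ : ℕ∞) (extension f) p :=
    (contDiffOn_extension f).contDiffAt (hO.mem_nhds p.2)
  have key (v w : E) : (deriv hO v (deriv hO w f)).1 p
      = fderiv ℝ (fderiv ℝ (extension f)) p v w := by
    rw [deriv_apply hO v (deriv hO w f) (g := fun q => fderiv ℝ (extension f) q w) (fun _ => rfl),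
      fderiv_clm_apply ((hf.fderiv_right (m := 1) (by rwa [one_add_one_eq_two])).differentiableAt
        (by simp)) (differentiableAt_const _)]
    simp
  rw [key, key]
  exact (hf.isSymmSndFDerivAt (by simpa using h2)).eq v w

end smoothAlgebra

end SmoothFunctions

section Representation

open smoothAlgebra

variable {n : ℕ} {O : Set (Vec n × Vec n)}

/-- Evaluation at a point of `O`. -/
def evalAt (p : O) : smoothAlgebra O →ₐ[ℝ] ℝ :=
  (Pi.evalAlgHom ℝ (fun _ : O => ℝ) p).comp (smoothAlgebra O).val

lemma ext_evalAt {F F' : smoothAlgebra O} (h : ∀ p, evalAt p F = evalAt p F') : F = F' :=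
  Subtype.ext (funext h)

/-- The element `F` of the algebra of smooth functions on `O` is the restriction of `f`. -/
def Represents (F : smoothAlgebra O) (f : Vec n → Vec n → ℝ) : Prop :=
  ∀ p : O, evalAt p F = f p.1.1 p.1.2

lemma Represents.eq_zero {F : smoothAlgebra O} {f : Vec n → Vec n → ℝ} (h : Represents F f)
    (hf : ∀ p ∈ O, f p.1 p.2 = 0) : F = 0 := by
  ext p
  exact (h p).trans (hf p p.2)

lemma Represents.pdx (hO : IsOpen O) {F : smoothAlgebra O} {f : Vec n → Vec n → ℝ}
    (h : Represents F f) (i : Fin n) :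
    Represents (deriv hO (Pi.single i 1, 0) F) (pdx f i) := by
  intro p
  have hd : DifferentiableAt ℝ (fun q : Vec n × Vec n => f q.1 q.2) (p.1.1, p.1.2) :=
    differentiableAt_of_eq hO F (g := fun q => f q.1 q.2) h p
  change (deriv hO _ F).1 p = _
  rw [deriv_apply hO _ F (g := fun q => f q.1 q.2) h p]
  have hc := hd.hasFDerivAt.comp p.1.1 (hasFDerivAt_prodMk_left (𝕜 := ℝ) p.1.1 p.1.2)
  change _ = fderiv ℝ (fun x' => f x' p.1.2) p.1.1 _
  rw [show fderiv ℝ (fun x' => f x' p.1.2) p.1.1 = _ from hc.fderiv]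
  rfl

lemma Represents.pdy (hO : IsOpen O) {F : smoothAlgebra O} {f : Vec n → Vec n → ℝ}
    (h : Represents F f) (i : Fin n) :
    Represents (deriv hO (0, Pi.single i 1) F) (pdy f i) := by
  intro p
  have hd : DifferentiableAt ℝ (fun q : Vec n × Vec n => f q.1 q.2) (p.1.1, p.1.2) :=
    differentiableAt_of_eq hO F (g := fun q => f q.1 q.2) h p
  change (deriv hO _ F).1 p = _
  rw [deriv_apply hO _ F (g := fun q => f q.1 q.2) h p]
  have hc := hd.hasFDerivAt.comp p.1.2 (hasFDerivAt_prodMk_right (𝕜 := ℝ) p.1.1 p.1.2)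
  change _ = fderiv ℝ (fun y' => f p.1.1 y') p.1.2 _
  rw [show fderiv ℝ (fun y' => f p.1.1 y') p.1.2 = _ from hc.fderiv]
  rfl

lemma fderiv_apply_eq_sum {f : Vec n → ℝ} (y v : Vec n) :
    fderiv ℝ f y v = ∑ j, v j * fderiv ℝ f y (Pi.single j 1) := by
  conv_lhs => rw [pi_eq_sum_univ' v, map_sum]
  refine Finset.sum_congr rfl fun j _ => ?_
  rw [map_smul, smul_eq_mul]

lemma isOpen_prod_slit {U : Set (Vec n)} (hU : IsOpen U) : IsOpen (U ×ˢ slit n) :=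
  hU.prod isOpen_ne

/-- The smooth functions on the slit tangent bundle of `U`, with the spray `G`. -/
def sprayAlgebra {U : Set (Vec n)} (hU : IsOpen U) {G : Fin n → Vec n → Vec n → ℝ}
    (hG : IsSpray U G) : SprayAlgebra n (smoothAlgebra (U ×ˢ slit n)) where
  X i := deriv (isOpen_prod_slit hU) (Pi.single i 1, 0)
  Y i := deriv (isOpen_prod_slit hU) (0, Pi.single i 1)
  y i := mk (fun p => p.2 i) (by fun_prop)
  g i := mk (fun p => G i p.1 p.2) (hG.1 i)
  XX i j a := deriv_comm _ _ _ _
  YX i j a := deriv_comm _ _ _ _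
  YY i j a := deriv_comm _ _ _ _
  Xy i j := by
    ext p
    rw [deriv_apply _ _ _ (g := fun p : Vec n × Vec n => p.2 j) (fun _ => rfl)]
    have h : HasFDerivAt (fun p : Vec n × Vec n => p.2 j)
      ((ContinuousLinearMap.proj j).comp (ContinuousLinearMap.snd ℝ (Vec n) (Vec n))) p.1 :=
      ((ContinuousLinearMap.proj j).comp
        (ContinuousLinearMap.snd ℝ (Vec n) (Vec n))).hasFDerivAt
    rw [h.fderiv]
    simp
  Yy i j := by
    ext p
    rw [deriv_apply _ _ _ (g := fun p : Vec n × Vec n => p.2 j) (fun _ => rfl)]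
    have h : HasFDerivAt (fun p : Vec n × Vec n => p.2 j)
      ((ContinuousLinearMap.proj j).comp (ContinuousLinearMap.snd ℝ (Vec n) (Vec n))) p.1 :=
      ((ContinuousLinearMap.proj j).comp
        (ContinuousLinearMap.snd ℝ (Vec n) (Vec n))).hasFDerivAt
    rw [h.fderiv]
    split_ifs with hij <;> simp [hij]
  euler i := by
    refine ext_evalAt fun p => ?_
    obtain ⟨⟨x, y⟩, hx, hy⟩ := p
    set p : (U ×ˢ slit n : Set (Vec n × Vec n)) := ⟨(x, y), hx, hy⟩
    have hr : Represents (mk (fun p => G i p.1 p.2) (hG.1 i)) (G i) := fun _ => rfl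
    have hd : DifferentiableAt ℝ (fun q : Vec n × Vec n => G i q.1 q.2) (x, y) :=
      differentiableAt_of_eq (isOpen_prod_slit hU)
        (mk (fun p => G i p.1 p.2) (hG.1 i)) (fun _ => rfl) p
    have hdy : DifferentiableAt ℝ (G i x) y :=
      hd.comp y (f := fun y' => (x, y')) (by fun_prop)
    have h1 : HasDerivAt (fun c : ℝ => G i x (c • y)) (fderiv ℝ (G i x) y y) 1 := by
      have hl : HasDerivAt (fun c : ℝ => c • y) y 1 := by
        simpa using (hasDerivAt_id (1 : ℝ)).smul_const y
      exact HasFDerivAt.comp_hasDerivAt (1 : ℝ) (by simpa using hdy.hasFDerivAt) hl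
    have h2 : HasDerivAt (fun c : ℝ => G i x (c • y)) (2 * G i x y) 1 := by
      have hl : HasDerivAt (fun c : ℝ => c ^ 2 * G i x y) (2 * G i x y) 1 := by
        simpa using (hasDerivAt_pow 2 (1 : ℝ)).mul_const (G i x y)
      refine hl.congr_of_eventuallyEq ?_
      filter_upwards [lt_mem_nhds (zero_lt_one (α := ℝ))] with c hc
      exact hG.2 i x hx y hy c hc
    rw [map_sum, map_mul, map_ofNat]
    refine Eq.trans ?_ (h1.unique h2)
    rw [fderiv_apply_eq_sum]
    refine Finset.sum_congr rfl fun j _ => ?_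
    rw [map_mul, hr.pdy (isOpen_prod_slit hU) j p]
    rfl

section Tensors

variable {U : Set (Vec n)} (hU : IsOpen U) {G : Fin n → Vec n → Vec n → ℝ} (hG : IsSpray U G)

lemma represents_X {F : smoothAlgebra (U ×ˢ slit n)} {f : Vec n → Vec n → ℝ}
    (h : Represents F f) (i : Fin n) : Represents ((sprayAlgebra hU hG).X i F) (pdx f i) :=
  h.pdx (isOpen_prod_slit hU) i

lemma represents_Y {F : smoothAlgebra (U ×ˢ slit n)} {f : Vec n → Vec n → ℝ}
    (h : Represents F f) (i : Fin n) : Represents ((sprayAlgebra hU hG).Y i F) (pdy f i) :=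
  h.pdy (isOpen_prod_slit hU) i

lemma represents_y (i : Fin n) : Represents ((sprayAlgebra hU hG).y i) (fun _ y => y i) :=
  fun _ => rfl

variable {G' : Fin n → Vec n → Vec n → ℝ} (hG' : ∀ i, ∀ x ∈ U, ∀ y ∈ slit n, G' i x y = G i x y)

include hG'

lemma represents_g (i : Fin n) : Represents ((sprayAlgebra hU hG).g i) (G' i) :=
  fun p => (hG' i _ p.2.1 _ p.2.2).symm

lemma represents_N (i j : Fin n) : Represents ((sprayAlgebra hU hG).N i j) (Nc G' i j) :=
  represents_Y hU hG (represents_g hU hG hG' i) j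

lemma represents_Γ (i j k : Fin n) : Represents ((sprayAlgebra hU hG).Γ i j k) (Γc G' i j k) :=
  represents_Y hU hG (represents_N hU hG hG' i j) k

lemma represents_δ {F : smoothAlgebra (U ×ˢ slit n)} {f : Vec n → Vec n → ℝ}
    (h : Represents F f) (k : Fin n) : Represents ((sprayAlgebra hU hG).δ k F) (hD G' f k) := by
  intro p
  simp only [SprayAlgebra.δ_apply, map_sub, map_sum, map_mul, represents_X hU hG h k p,
    represents_N hU hG hG' _ _ p, represents_Y hU hG h _ p, hD]

lemma represents_riem (i k : Fin n) : Represents ((sprayAlgebra hU hG).riem i k) (Riem G' i k) := by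
  intro p
  simp only [SprayAlgebra.riem, map_sub, map_add, map_sum, map_mul, map_ofNat,
    represents_X hU hG (represents_g hU hG hG' i) k p, represents_y hU hG _ p,
    represents_g hU hG hG' _ p,
    represents_Y hU hG (represents_X hU hG (represents_g hU hG hG' i) _) k p,
    represents_Γ hU hG hG' _ _ _ p, represents_N hU hG hG' _ _ p, Riem]

lemma represents_ricci : Represents (sprayAlgebra hU hG).ricci (Ricci G') := by
  intro p
  simp only [SprayAlgebra.ricci, map_sum, map_mul, AlgHom.commutes, Algebra.algebraMap_self,
    RingHom.id_apply, represents_riem hU hG hG' _ _ p, Ricci, div_eq_mul_inv]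

lemma represents_T (i k : Fin n) : Represents ((sprayAlgebra hU hG).T i k) (Tcurv G' i k) := by
  intro p
  simp only [SprayAlgebra.T, map_sub, map_mul, AlgHom.commutes, Algebra.algebraMap_self,
    RingHom.id_apply, represents_riem hU hG hG' _ _ p, represents_ricci hU hG hG' p,
    represents_Y hU hG (represents_ricci hU hG hG') k p, represents_y hU hG _ p, Tcurv,
    apply_ite (evalAt p), map_one, map_zero]

lemma represents_χ (i : Fin n) : Represents ((sprayAlgebra hU hG).χ i) (chiC G' i) := by
  intro p
  simp only [SprayAlgebra.χ, map_sum, map_mul, AlgHom.commutes, Algebra.algebraMap_self,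
    RingHom.id_apply, represents_Y hU hG (represents_T hU hG hG' _ i) _ p, chiC]

lemma represents_weyl (i k : Fin n) : Represents ((sprayAlgebra hU hG).weyl i k) (Weyl G' i k) := by
  intro p
  simp only [SprayAlgebra.weyl, map_add, map_mul, map_ofNat, AlgHom.commutes,
    Algebra.algebraMap_self, RingHom.id_apply, represents_T hU hG hG' _ _ p,
    represents_χ hU hG hG' _ p, represents_y hU hG _ p, Weyl, div_eq_mul_inv]

lemma represents_div_weyl (k : Fin n) :
    Represents ((sprayAlgebra hU hG).div (sprayAlgebra hU hG).weyl k)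
      (fun x y => ∑ m, covD11 G' (Weyl G') m k m x y) := by
  intro p
  simp only [SprayAlgebra.div, map_sub, map_add, map_sum, map_mul,
    represents_δ hU hG hG' (represents_weyl hU hG hG' _ _) _ p,
    represents_weyl hU hG hG' _ _ p, represents_Γ hU hG hG' _ _ _ p, covD11]

lemma represents_bweyl (k : Fin n) : Represents ((sprayAlgebra hU hG).bweyl k) (fun x y =>
    hD G' (Ricci G') k x y
      - (1 / 2) * ∑ m, covD1 G' (fun j => pdy (Ricci G') j) k m x y * y m) := by
  intro p
  have hR := represents_ricci hU hG hG'
  simp only [SprayAlgebra.bweyl, map_sub, map_sum, map_mul, AlgHom.commutes,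
    Algebra.algebraMap_self, RingHom.id_apply, represents_δ hU hG hG' hR k p,
    represents_δ hU hG hG' (represents_Y hU hG hR k) _ p, represents_Y hU hG hR _ p,
    represents_Γ hU hG hG' _ _ _ p, represents_y hU hG _ p, covD1]

end Tensors

end Representation


/-- Rescaling a volume form by `exp ((n + 1) φ)` changes the S-curvature by
`-(n + 1) φ_{x^m} y^m`. -/
lemma Scurv_mul_exp {n : ℕ} {U : Set (Vec n)} (hU : IsOpen U) (G : Fin n → Vec n → Vec n → ℝ)
    {σ φ : Vec n → ℝ} (hσ : IsVolumeForm U σ) (hφ : ContDiffOn ℝ (⊤ : ℕ∞) φ U)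
    {x : Vec n} (hx : x ∈ U) (y : Vec n) :
    Scurv G (fun x => σ x * Real.exp (((n : ℝ) + 1) * φ x)) x y
      = Scurv G σ x y - ((n : ℝ) + 1) * ∑ m, fderiv ℝ φ x (Pi.single m 1) * y m := by
  have hdσ : DifferentiableAt ℝ (fun x' => Real.log (σ x')) x :=
    ((hσ.1.differentiableOn (by simp)).differentiableAt (hU.mem_nhds hx)).log (hσ.2 x hx).ne'
  have hdφ : DifferentiableAt ℝ φ x :=
    (hφ.differentiableOn (by simp)).differentiableAt (hU.mem_nhds hx)
  have he : (fun x' => Real.log (σ x' * Real.exp (((n : ℝ) + 1) * φ x')))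
      =ᶠ[nhds x] fun x' => Real.log (σ x') + ((n : ℝ) + 1) * φ x' := by
    filter_upwards [hU.mem_nhds hx] with z hz
    rw [Real.log_mul (hσ.2 z hz).ne' (Real.exp_pos _).ne', Real.log_exp]
  simp only [Scurv]
  rw [he.fderiv_eq, fderiv_fun_add hdσ (hdφ.const_mul _), fderiv_const_mul hdφ, sub_sub,
    Finset.mul_sum, ← Finset.sum_add_distrib]
  congr 1
  refine Finset.sum_congr rfl fun m _ => ?_
  simp only [add_apply, smul_apply, smul_eq_mul]
  ring

/-- Corollary 4.4: if `W^m_{k|m} = 0` and the S-curvature of some volume form is an exact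
1-form, `S = (n+1) φ_{x^m} y^m`, then `G` is BWeyl-flat. -/
theorem stmt_17 {n : ℕ} (hn : 3 ≤ n) (U : Set (Vec n)) (hU : IsOpen U) (hUne : U.Nonempty)
    (G : Fin n → Vec n → Vec n → ℝ) (hG : IsSpray U G)
    (hdiv : ∀ x ∈ U, ∀ y ∈ slit n, ∀ k : Fin n, ∑ m, covD11 G (Weyl G) m k m x y = 0)
    (σ : Vec n → ℝ) (hσ : IsVolumeForm U σ)
    (φ : Vec n → ℝ) (hφ : ContDiffOn ℝ (⊤ : ℕ∞) φ U)
    (hS : ∀ x ∈ U, ∀ y ∈ slit n,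
      Scurv G σ x y = ((n : ℝ) + 1) * ∑ m, fderiv ℝ φ x (Pi.single m 1) * y m) :
    ∃ σ' : Vec n → ℝ, IsVolumeForm U σ' ∧
      ∀ x ∈ U, ∀ y ∈ slit n, ∀ k : Fin n, BWeyl G σ' k x y = 0 := by
  have hσ' : IsVolumeForm U (fun x => σ x * Real.exp (((n : ℝ) + 1) * φ x)) :=
    ⟨hσ.1.mul (contDiffOn_const.mul hφ).exp, fun x hx => mul_pos (hσ.2 x hx) (Real.exp_pos _)⟩
  refine ⟨_, hσ', ?_⟩
  set σ' : Vec n → ℝ := fun x => σ x * Real.exp (((n : ℝ) + 1) * φ x)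
  have hS' (x) (hx : x ∈ U) (y) (hy : y ∈ slit n) : Scurv G σ' x y = 0 := by
    rw [Scurv_mul_exp hU G hσ hφ hx, hS x hx y hy, sub_self]
  have hg (i : Fin n) (x) (_ : x ∈ U) (y) (_ : y ∈ slit n) : G i x y = G i x y := rfl
  have hg' (i : Fin n) (x) (hx : x ∈ U) (y) (hy : y ∈ slit n) : Ghat G σ' i x y = G i x y := by
    rw [Ghat, hS' _ hx _ hy, zero_div, zero_mul, sub_zero]
  let L : smoothAlgebra (U ×ˢ slit n) := smoothAlgebra.mk (fun p => Real.log (σ' p.1))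
    ((hσ'.1.comp contDiffOn_fst fun p hp => hp.1).log fun p hp => (hσ'.2 p.1 hp.1).ne')
  have hLr : Represents L (fun x _ => Real.log (σ' x)) := fun _ => rfl
  have hYL (i : Fin n) : (sprayAlgebra hU hG).Y i L = 0 :=
    (represents_Y hU hG hLr i).eq_zero fun p _ => by simp [pdy]
  have hL : ∑ m, (sprayAlgebra hU hG).N m m
      = ∑ m, (sprayAlgebra hU hG).y m * (sprayAlgebra hU hG).X m L := by
    refine ext_evalAt fun p => ?_
    simp only [map_sum, map_mul, represents_N hU hG hg _ _ p, represents_y hU hG _ p,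
      represents_X hU hG hLr _ p]
    exact sub_eq_zero.1 (hS' _ p.2.1 _ p.2.2)
  have hdiv' (k : Fin n) : (sprayAlgebra hU hG).div (sprayAlgebra hU hG).weyl k = 0 :=
    (represents_div_weyl hU hG hg k).eq_zero fun p hp => hdiv _ hp.1 _ hp.2 k
  intro x hx y hy k
  have h := represents_bweyl hU hG hg' k ⟨(x, y), hx, hy⟩
  rw [SprayAlgebra.bweyl_eq_zero hYL hL hn hdiv', map_zero] at h
  exact h.symm

end BerwaldWeyl
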